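/- If G is a finite simple group with U(G) = {1, rq, 16q, 4qr, 16r} for distinct odd primes q and r, then the conjugacy class sizes of G are pairwise distinct, i.e., G has exactly 5 distinct conjugacy class sizes (one per equivalence class). -/

import Mathlib

open scoped MatrixGroups

/-- The size of the conjugacy class of `x`. -/
noncomputable def classSize {G : Type*} [Group G] (x : G) : ℕ :=
  Nat.card {y : G // IsConj x y}

/-- `u_G(n)`: the number of elements of `G` whose conjugacy class has size `n`. -/
noncomputable def sameSizeCount (G : Type*) [Group G] (n : ℕ) : ℕ :=
  Nat.card {x : G // classSize x = n}

/-- `U(G)`: the same-size conjugacy class set of `G`. -/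
def sameSizeSet (G : Type*) [Group G] : Set ℕ :=
  {m | ∃ x : G, m = sameSizeCount G (classSize x)}

namespace Aux17
section grp
open Subgroup
variable {G : Type*} [Group G] [Finite G]

theorem classSize_eq_index (x : G) : classSize x = (centralizer {x}).index := by
  have h1 : classSize x = (MulAction.stabilizer (ConjAct G) x).index := by
    rw [MulAction.index_stabilizer, classSize, ← Nat.card_coe_set_eq]
    apply Nat.card_congr
    apply Equiv.subtypeEquivRight
    intro y
    rw [ConjAct.mem_orbit_conjAct]
    exact ⟨IsConj.symm, IsConj.symm⟩
  have h2 := (MulAction.stabilizer (ConjAct G) x).card_mul_index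
  have h3 := (centralizer {x}).card_mul_index
  rw [nat_card_centralizer_nat_card_stabilizer] at h3
  have h4 : Nat.card (ConjAct G) = Nat.card G := rfl
  have h5 : 0 < Nat.card (MulAction.stabilizer (ConjAct G) x) := by
    rw [← nat_card_centralizer_nat_card_stabilizer]
    exact Nat.card_pos
  rw [h1]
  apply Nat.eq_of_mul_eq_mul_left h5
  rw [h2, h3, h4]

theorem classSize_congr {G : Type*} [Group G] {x y : G} (h : IsConj x y) : classSize x = classSize y := by
  apply Nat.card_congr
  apply Equiv.subtypeEquivRight
  intro z
  exact ⟨fun h' => h.symm.trans h', fun h' => h.trans h'⟩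

theorem classSize_dvd_count (n : ℕ) : n ∣ sameSizeCount G n := by
  classical
  have := Fintype.ofFinite G
  unfold sameSizeCount
  rw [Nat.card_eq_fintype_card, Fintype.card_subtype]
  rw [Finset.card_eq_sum_card_image (fun x : G => ConjClasses.mk x)]
  apply Finset.dvd_sum
  intro c hc
  rw [Finset.mem_image] at hc
  obtain ⟨x, hx, rfl⟩ := hc
  rw [Finset.mem_filter] at hx
  apply dvd_of_eq
  conv_lhs => rw [← hx.2]
  rw [classSize, Nat.card_eq_fintype_card, Fintype.card_subtype]
  congr 1
  ext y
  simp only [Finset.mem_filter, Finset.mem_univ, true_and, ConjClasses.mk_eq_mk_iff_isConj]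
  constructor
  · intro h
    exact ⟨(classSize_congr h).symm.trans hx.2, h.symm⟩
  · intro h
    exact h.2.symm

theorem sum_count : ∃ cs : Finset ℕ, (∀ n, n ∈ cs ↔ ∃ x : G, classSize x = n) ∧
    Nat.card G = ∑ n ∈ cs, sameSizeCount G n := by
  classical
  have := Fintype.ofFinite G
  refine ⟨Finset.univ.image (fun x : G => classSize x), by simp, ?_⟩
  rw [Nat.card_eq_fintype_card, ← Finset.card_univ,
    Finset.card_eq_sum_card_image (fun x : G => classSize x)]
  apply Finset.sum_congr rfl
  intro n _
  rw [sameSizeCount, Nat.card_eq_fintype_card, Fintype.card_subtype]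

theorem dvd_factorial [IsSimpleGroup G] (H : Subgroup G) (hH : H.index ≠ 1) :
    Nat.card G ∣ H.index.factorial := by
  have h : H.normalCore = ⊥ := by
    rcases H.normalCore_normal.eq_bot_or_eq_top with h | h
    · exact h
    · exact absurd (index_eq_one.2 (top_le_iff.1 (h ▸ H.normalCore_le))) hH
  rw [normalCore_eq_ker, MonoidHom.ker_eq_bot_iff] at h
  have := card_dvd_of_injective _ h
  rwa [Nat.card_perm] at this

theorem classSize_one_iff [IsSimpleGroup G] (hna : ¬ ∀ a b : G, a * b = b * a) (x : G) :
    classSize x = 1 ↔ x = 1 := by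
  rw [classSize_eq_index, index_eq_one]
  have hc : center G = ⊥ := by
    rcases (inferInstance : (center G).Normal).eq_bot_or_eq_top with h | h
    · exact h
    · exfalso
      apply hna
      intro a b
      have : b ∈ center G := h ▸ mem_top b
      exact mem_center_iff.1 this a
  constructor
  · intro h
    have : x ∈ center G := by
      rw [mem_center_iff]
      intro g
      have : g ∈ centralizer {x} := h ▸ mem_top g
      exact (mem_centralizer_singleton_iff.1 this)
    rwa [hc, mem_bot] at this
  · rintro rfl
    rw [eq_top_iff]
    intro g _
    rw [mem_centralizer_singleton_iff]
    simp

theorem self_centralizing [IsSimpleGroup G] {p : ℕ} [Fact p.Prime] (P : Sylow p G)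
    (hP : Nat.card P = p) (hk : Nat.card (Sylow p G) = p + 1) (hPn : normalizer (P : Set G) ≠ ⊤) :
    centralizer (P : Set G) ≤ P := by
  have hp : p.Prime := Fact.out
  have hcyc : IsCyclic P := isCyclic_of_prime_card hP
  have hPC : ∀ a ∈ P, ∀ b ∈ P, a * b = b * a := by
    intro a ha b hb
    have := hcyc.isMulCommutative.is_comm.comm (⟨a, ha⟩ : P) ⟨b, hb⟩
    exact congrArg Subtype.val this
  -- transitivity
  have htr : ∀ Q R : Sylow p G, Q ≠ P → R ≠ P → ∃ g ∈ P, g • Q = R := by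
    intro Q R hQ hR
    have hPp : IsPGroup p (P : Subgroup G) := P.isPGroup'
    have hsub : MulAction.orbit (P : Subgroup G) Q ⊆ {P}ᶜ := by
      rintro _ ⟨g, rfl⟩ h
      apply hQ
      have h : (g : G) • Q = P := h
      have h2 : (g : G)⁻¹ • P = Q := inv_smul_eq_iff.2 h.symm
      rw [← h2]
      exact Sylow.smul_eq_iff_mem_normalizer.2 (le_normalizer (inv_mem g.2))
    have hcard : p ≤ (MulAction.orbit (P : Subgroup G) Q).ncard := by
      obtain ⟨n, hn⟩ := hPp.card_orbit Q
      rw [Nat.card_coe_set_eq] at hn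
      rw [hn]
      rcases Nat.eq_zero_or_pos n with h0 | h0
      · exfalso
        rw [h0, pow_zero, Set.ncard_eq_one] at hn
        obtain ⟨a, ha⟩ := hn
        have hfix : Q ∈ MulAction.fixedPoints (P : Subgroup G) (Sylow p G) := by
          intro g
          have h1 : g • Q ∈ MulAction.orbit (P : Subgroup G) Q := MulAction.mem_orbit _ _
          have h2 : Q ∈ MulAction.orbit (P : Subgroup G) Q := MulAction.mem_orbit_self _
          rw [ha] at h1 h2
          exact h1.trans h2.symm
        rw [hPp.sylow_mem_fixedPoints_iff] at hfix
        exact hQ (Sylow.ext (P.is_maximal' Q.isPGroup' hfix))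
      · exact Nat.le_self_pow h0.ne' p
    have hc2 : ({P}ᶜ : Set (Sylow p G)).ncard = p := by
      rw [Set.ncard_compl, Set.ncard_singleton, hk]; rfl
    have heq : MulAction.orbit (P : Subgroup G) Q = {P}ᶜ :=
      Set.eq_of_subset_of_ncard_le hsub (by rw [hc2]; exact hcard)
    have : R ∈ MulAction.orbit (P : Subgroup G) Q := by rw [heq]; exact hR
    obtain ⟨g, hg⟩ := this
    exact ⟨g, g.2, hg⟩
  obtain ⟨Q, hQ⟩ : ∃ Q : Sylow p G, Q ≠ P := by
    by_contra! h
    have : Nat.card (Sylow p G) ≤ 1 := by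
      have : Subsingleton (Sylow p G) := ⟨fun a b => (h a).trans (h b).symm⟩
      exact Finite.card_le_one_iff_subsingleton.2 this
    have := hp.two_le
    omega
  have hker : (MulAction.toPermHom G (Sylow p G)).ker = ⊥ := by
    rcases (inferInstance : (MulAction.toPermHom G (Sylow p G)).ker.Normal).eq_bot_or_eq_top with h | h
    · exact h
    · exfalso
      apply hPn
      rw [eq_top_iff]
      intro g _
      have hg : g ∈ (MulAction.toPermHom G (Sylow p G)).ker := h ▸ mem_top g
      rw [MonoidHom.mem_ker] at hg
      exact Sylow.smul_eq_iff_mem_normalizer.1 (congrArg (fun e => e P) hg)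
  intro y hy
  have hyP : ∀ z ∈ centralizer (P : Set G), z • P = P := fun z hz =>
    Sylow.smul_eq_iff_mem_normalizer.2 (centralizer_le_normalizer _ hz)
  have hyQ : y • Q ≠ P := by
    intro h
    apply hQ
    have h2 : y⁻¹ • P = Q := by rw [← h, inv_smul_smul]
    rw [← h2]
    exact hyP _ (inv_mem hy)
  obtain ⟨g, hg, hgQ⟩ := htr Q (y • Q) hQ hyQ
  have hgC : g ∈ centralizer (P : Set G) := by
    rw [mem_centralizer_iff]
    intro h hh
    exact hPC _ hh _ hg
  have hz : g⁻¹ * y ∈ centralizer (P : Set G) := mul_mem (inv_mem hgC) hy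
  have hzQ : (g⁻¹ * y) • Q = Q := by rw [mul_smul, ← hgQ, inv_smul_smul]
  have : g⁻¹ * y ∈ (MulAction.toPermHom G (Sylow p G)).ker := by
    rw [MonoidHom.mem_ker]
    ext1 R
    change (g⁻¹ * y) • R = R
    by_cases hR : R = P
    · rw [hR]; exact hyP _ hz
    · obtain ⟨h, hh, rfl⟩ := htr Q R hQ hR
      rw [smul_smul, ← (mem_centralizer_iff.1 hz h hh), mul_smul, hzQ]
  rw [hker, mem_bot, inv_mul_eq_one] at this
  rw [← this]
  exact hg

theorem sylow_data [IsSimpleGroup G] (hna : ¬ ∀ a b : G, a * b = b * a) {p : ℕ} (hp : p.Prime)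
    (hpN : p ∣ Nat.card G) (hpp : ¬ p * p ∣ Nat.card G) :
    ∃ k e : ℕ, k % p = 1 ∧ 1 < k ∧ 1 < e ∧ e ∣ p - 1 ∧ (∃ x : G, classSize x = k * e) ∧
      k * e * p ∣ Nat.card G ∧ Nat.card G ∣ k.factorial ∧ (k = p + 1 → k * e * p = Nat.card G) := by
  have : Fact p.Prime := ⟨hp⟩
  obtain ⟨P⟩ : Nonempty (Sylow p G) := inferInstance
  have hN0 : Nat.card G ≠ 0 := Nat.card_pos.ne'
  have hP : Nat.card P = p := by
    have h := P.card_eq_multiplicity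
    have h1 : (Nat.card G).factorization p = 1 := by
      have ha : 1 ≤ (Nat.card G).factorization p := (hp.dvd_iff_one_le_factorization hN0).1 hpN
      have hb : ¬ 2 ≤ (Nat.card G).factorization p := by
        intro h2
        exact hpp (by rw [← pow_two]; exact (hp.pow_dvd_iff_le_factorization hN0).2 h2)
      omega
    rw [h1, pow_one] at h
    exact h
  have hcyc : IsCyclic P := isCyclic_of_prime_card hP
  have hPbot : (P : Subgroup G) ≠ ⊥ := by
    intro h
    have : Nat.card (P : Subgroup G) = 1 := by rw [h]; simp
    have h2 := hp.two_le
    have h3 : Nat.card (P : Subgroup G) = p := hP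
    omega
  have hcomm : ∀ a ∈ P, ∀ b ∈ P, a * b = b * a := by
    intro a ha b hb
    have := hcyc.isMulCommutative.is_comm.comm (⟨a, ha⟩ : P) ⟨b, hb⟩
    exact congrArg Subtype.val this
  have hPtop : (P : Subgroup G) ≠ ⊤ := by
    intro h
    apply hna
    intro a b
    have hm : ∀ c : G, c ∈ (P : Subgroup G) := fun c => h ▸ mem_top c
    exact hcomm a (hm a) b (hm b)
  have hPC : (P : Subgroup G) ≤ centralizer (P : Set G) := by
    intro g hg
    rw [mem_centralizer_iff]
    intro h hh
    exact hcomm _ hh _ hg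
  have hnorm : normalizer (P : Set G) ≠ ⊤ := by
    intro h
    have : (P : Subgroup G).Normal := normalizer_eq_top_iff.1 h
    rcases this.eq_bot_or_eq_top with h | h
    · exact hPbot h
    · exact hPtop h
  have hCN : centralizer (P : Set G) ≤ normalizer (P : Set G) := centralizer_le_normalizer _
  obtain ⟨x, hx⟩ : ∃ x : G, zpowers x = (P : Subgroup G) := by
    obtain ⟨x, hx⟩ := hcyc.exists_generator
    refine ⟨x, le_antisymm ?_ ?_⟩
    · rw [zpowers_le]; exact x.2
    · intro y hy
      obtain ⟨n, hn⟩ := hx ⟨y, hy⟩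
      refine ⟨n, ?_⟩
      have := congrArg Subtype.val hn
      simpa using this
  have hxC : centralizer {x} = centralizer (P : Set G) := by
    have : (P : Set G) = (zpowers x : Set G) := by rw [hx]; rfl
    rw [this, zpowers_eq_closure, centralizer_closure]
  have hmul : (centralizer (P : Set G)).relIndex (normalizer (P : Set G)) *
      (normalizer (P : Set G)).index = (centralizer (P : Set G)).index := relIndex_mul_index hCN
  have hcard := (centralizer (P : Set G)).card_mul_index
  have hkidx := P.card_eq_index_normalizer
  refine ⟨(normalizer (P : Set G)).index, (centralizer (P : Set G)).relIndex (normalizer (P : Set G)),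
    ?_, ?_, ?_, ?_, ⟨x, ?_⟩, ?_, ?_, ?_⟩
  · rw [← hkidx]
    have := card_sylow_modEq_one p G
    rw [Nat.ModEq, Nat.mod_eq_of_lt hp.one_lt] at this
    exact this
  · have h1 : (normalizer (P : Set G)).index ≠ 1 := fun h => hnorm (index_eq_one.1 h)
    have h0 : (normalizer (P : Set G)).index ≠ 0 := FiniteIndex.index_ne_zero
    omega
  · have h1 : (centralizer (P : Set G)).relIndex (normalizer (P : Set G)) ≠ 1 := by
      intro h
      have hle := relIndex_eq_one.1 h
      have hc := MonoidHom.ker_transferSylow_isComplement' P hle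
      rcases (inferInstance : (MonoidHom.transferSylow P hle).ker.Normal).eq_bot_or_eq_top with h | h
      · rw [h] at hc
        exact hPtop (isComplement'_bot_left.1 hc)
      · rw [h] at hc
        exact hPbot (isComplement'_top_left.1 hc)
    have h0 : (centralizer (P : Set G)).relIndex (normalizer (P : Set G)) ≠ 0 :=
      fun h => FiniteIndex.index_ne_zero h
    omega
  · have key := card_dvd_of_injective _ (QuotientGroup.kerLift_injective P.normalizerMonoidHom)
    rw [normalizerMonoidHom_ker, ← index, ← relIndex, hcyc.card_mulAut] at key
    rw [hP, Nat.totient_prime hp] at key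
    exact key
  · rw [classSize_eq_index, hxC, ← hmul, mul_comm]
  · rw [← hcard, mul_comm _ (relIndex _ _), hmul, mul_comm]
    apply Nat.mul_dvd_mul_right
    have := card_dvd_of_le hPC
    rwa [show Nat.card (P : Subgroup G) = p from hP] at this
  · exact dvd_factorial _ (fun h => hnorm (index_eq_one.1 h))
  · intro hk
    have := self_centralizing P hP (hkidx.trans hk) hnorm
    have heq : centralizer (P : Set G) = P := le_antisymm this hPC
    rw [mul_comm _ (relIndex _ _), hmul, ← hcard]
    conv_rhs => rw [heq]
    rw [show Nat.card (P : Subgroup G) = p from hP, mul_comm]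
    congr 1
    rw [heq]
end grp
end Aux17

namespace Aux17
def fd (n N : ℕ) : Bool := Nat.ble 40 n || Nat.beq (n.factorial % N) 0
def okk (N n : ℕ) : Bool := Nat.ble 2 n && Nat.beq (N % n) 0 && fd n N
def L16 (q : ℕ) : List ℕ := [1, 2, 4, 8, 16, q, 2 * q, 4 * q, 8 * q, 16 * q]
def L4 (q r : ℕ) : List ℕ := [1, 2, 4, q, 2 * q, 4 * q, r, 2 * r, 4 * r, q * r, 2 * (q * r), 4 * (q * r)]
def L1 (q r : ℕ) : List ℕ := [1, q, r, q * r]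
def cnt (N : ℕ) (l : List ℕ) : ℕ := (l.filter (okk N)).length
def syl (N p s : ℕ) : Bool :=
  Nat.beq (N % (p * p)) 0 ||
  (L16 s).any fun k => Nat.ble 2 k && Nat.beq (k % p) 1 && fd k N &&
    (L16 s).any fun e => Nat.ble 2 e && Nat.beq ((p - 1) % e) 0 && Nat.beq (N % (k * e * p)) 0 &&
      okk N (k * e) && (L16 s).contains (k * e) && (!(Nat.beq k (p + 1)) || Nat.beq (k * e * p) N)
def sp (n : ℕ) : Bool := [2, 3, 5, 7].all fun d => !(Nat.beq (n % d) 0) || Nat.beq n d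
def good (q r t a1 a2 a3 a4 : ℕ) : Bool :=
  let N := q * r * (t + a1 + 4 * a3)
  Nat.ble a1 (cnt N (L1 q r)) && Nat.ble a2 (cnt N (L16 q)) && Nat.ble a3 (cnt N (L4 q r)) &&
  Nat.ble a4 (cnt N (L16 r)) && syl N q r && syl N r q
def rng (n : ℕ) : List ℕ := (List.range n).map (· + 1)
def chk2 (q t a2 a4 : ℕ) : Bool :=
  let d := t * q - 16 * a4
  let M := 1 + 16 * a2 * q
  let r := M / d
  Nat.beq d 0 || !(Nat.beq (M % d) 0) || Nat.ble r q || !(sp r) ||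
  (rng 3).all fun a1 => (rng 11).all fun a3 => !(good q r t a1 a2 a3 a4)
def chk (q : ℕ) : Bool :=
  Nat.ble q 2 || !(sp q) || (rng (289 / q)).all fun t => (rng 9).all fun a2 => (rng 9).all fun a4 => chk2 q t a2 a4
set_option maxRecDepth 100000 in
theorem chk_all : ∀ q ∈ List.range 290, chk q = true := by decide +kernel

theorem beq_iff {a b : ℕ} : Nat.beq a b = true ↔ a = b := by rw [Nat.beq_eq]

structure Dat (q r N : ℕ) (cs : Finset ℕ) (u : ℕ → ℕ) : Prop where
  hsum : N = ∑ n ∈ cs, u n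
  hdiv : ∀ n ∈ cs, n ∣ u n
  hdN : ∀ n ∈ cs, n ∣ N
  hone : 1 ∈ cs
  hu1 : u 1 = 1
  hfac : ∀ n ∈ cs, n ≠ 1 → N ∣ n.factorial
  himg : cs.image u = {1, q * r, 16 * q, 4 * (q * r), 16 * r}
  hsyl : ∀ p, p.Prime → p ∣ N → ¬ p * p ∣ N →
    ∃ k e : ℕ, k % p = 1 ∧ 1 < k ∧ 1 < e ∧ e ∣ p - 1 ∧ k * e ∈ cs ∧
      k * e * p ∣ N ∧ N ∣ k.factorial ∧ (k = p + 1 → k * e * p = N)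

theorem Dat.symm {q r N cs u} (h : Dat q r N cs u) : Dat r q N cs u :=
  { h with
    himg := by
      rw [h.himg, mul_comm r q]
      ext x
      simp only [Finset.mem_insert, Finset.mem_singleton]
      tauto }

theorem dvd16 {k : ℕ} (h : k ∣ 16) : k = 1 ∨ k = 2 ∨ k = 4 ∨ k = 8 ∨ k = 16 := by
  have := Nat.le_of_dvd (by norm_num) h
  interval_cases k <;> revert h <;> decide

theorem dvd4 {k : ℕ} (h : k ∣ 4) : k = 1 ∨ k = 2 ∨ k = 4 := by
  have := Nat.le_of_dvd (by norm_num) h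
  interval_cases k <;> revert h <;> decide

theorem mem_L16 {q n : ℕ} (hq : q.Prime) (h : n ∣ 16 * q) : n ∈ L16 q := by
  obtain ⟨a, b, ha, hb, rfl⟩ := Nat.dvd_mul.1 h
  rcases (Nat.dvd_prime hq).1 hb with rfl | rfl <;>
  rcases dvd16 ha with rfl | rfl | rfl | rfl | rfl <;> simp [L16]

theorem mem_L1 {q r n : ℕ} (hq : q.Prime) (hr : r.Prime) (h : n ∣ q * r) : n ∈ L1 q r := by
  obtain ⟨a, b, ha, hb, rfl⟩ := Nat.dvd_mul.1 h
  rcases (Nat.dvd_prime hq).1 ha with rfl | rfl <;>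
  rcases (Nat.dvd_prime hr).1 hb with rfl | rfl <;> simp [L1]

theorem mem_L4 {q r n : ℕ} (hq : q.Prime) (hr : r.Prime) (h : n ∣ 4 * (q * r)) : n ∈ L4 q r := by
  obtain ⟨a, b, ha, hb, rfl⟩ := Nat.dvd_mul.1 h
  have := mem_L1 hq hr hb
  simp only [L1, List.mem_cons, List.not_mem_nil, or_false] at this
  rcases dvd4 ha with rfl | rfl | rfl <;> rcases this with rfl | rfl | rfl | rfl <;> simp [L4]

theorem fd_of {n N : ℕ} (h : N ∣ n.factorial) : fd n N = true := by
  simp only [fd, Bool.or_eq_true, Nat.ble_eq, beq_iff]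
  right
  exact Nat.mod_eq_zero_of_dvd h

section
variable {q r N : ℕ} {cs : Finset ℕ} {u : ℕ → ℕ}

theorem okk_of (h : Dat q r N cs u) {n : ℕ} (hn : n ∈ cs) (h1 : n ≠ 1) (hN : 0 < N) :
    okk N n = true := by
  have := Nat.pos_of_dvd_of_pos (h.hdN n hn) hN
  simp only [okk, Bool.and_eq_true, Nat.ble_eq, beq_iff]
  exact ⟨⟨by omega, Nat.mod_eq_zero_of_dvd (h.hdN n hn)⟩, fd_of (h.hfac n hn h1)⟩

theorem cnt_le (h : Dat q r N cs u) (hN : 0 < N) (v : ℕ) (hv : v ≠ 1) (l : List ℕ)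
    (hl : ∀ n, n ∣ v → n ∈ l) : (cs.filter (fun n => u n = v)).card ≤ cnt N l := by
  unfold cnt
  refine le_trans (Finset.card_le_card ?_) (List.toFinset_card_le _)
  intro n hn
  rw [Finset.mem_filter] at hn
  have h1 : n ≠ 1 := by
    rintro rfl
    exact hv (hn.2.symm.trans h.hu1)
  rw [List.mem_toFinset, List.mem_filter]
  exact ⟨hl n (hn.2 ▸ h.hdiv n hn.1), okk_of h hn.1 h1 hN⟩

theorem card_eq (h : Dat q r N cs u) (hq : q.Prime) (hr : r.Prime) (hq3 : 3 ≤ q) (hr3 : 3 ≤ r)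
    (hqr : q ≠ r) :
    ∃ a1 a2 a3 a4 : ℕ, 0 < a1 ∧ 0 < a2 ∧ 0 < a3 ∧ 0 < a4 ∧
      N = 1 + a1 * (q * r) + a2 * (16 * q) + a3 * (4 * (q * r)) + a4 * (16 * r) ∧
      a1 ≤ cnt N (L1 q r) ∧ a2 ≤ cnt N (L16 q) ∧ a3 ≤ cnt N (L4 q r) ∧ a4 ≤ cnt N (L16 r) := by
  have hNsum := h.hsum
  have hpos : ∀ v ∈ cs.image u, 0 < (cs.filter (fun n => u n = v)).card := by
    intro v hv
    rw [Finset.mem_image] at hv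
    obtain ⟨n, hn, hv⟩ := hv
    exact Finset.card_pos.2 ⟨n, Finset.mem_filter.2 ⟨hn, hv⟩⟩
  have hsc := Finset.sum_comp (s := cs) (fun n : ℕ => n) u
  rw [h.himg] at hpos hsc
  have hqr0 : q * r ≠ 0 := by positivity
  have hge : 9 ≤ q * r := Nat.mul_le_mul hq3 hr3
  have hq16 : q * r ≠ 16 * q := by
    intro h
    rw [mul_comm] at h
    have := Nat.eq_of_mul_eq_mul_right (by omega) h
    subst this
    revert hr; norm_num
  have hr16 : q * r ≠ 16 * r := by
    intro h
    have := Nat.eq_of_mul_eq_mul_right (by omega) h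
    subst this
    revert hq; norm_num
  have hq4 : 16 * q ≠ 4 * (q * r) := by
    intro h
    have h : q * 4 = q * r := by omega
    have := Nat.eq_of_mul_eq_mul_left (by omega) h
    subst this
    revert hr; norm_num
  have hr4 : 4 * (q * r) ≠ 16 * r := by
    intro h
    have h : q * r = 4 * r := by omega
    have := Nat.eq_of_mul_eq_mul_right (by omega) h
    subst this
    revert hq; norm_num
  have hS1 : (cs.filter (fun n => u n = 1)).card = 1 := by
    rw [Finset.card_eq_one]
    refine ⟨1, ?_⟩
    ext n
    rw [Finset.mem_filter, Finset.mem_singleton]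
    constructor
    · rintro ⟨hn, h1⟩
      exact Nat.dvd_one.1 (h1 ▸ h.hdiv n hn)
    · rintro rfl
      exact ⟨h.hone, h.hu1⟩
  rw [Finset.sum_insert, Finset.sum_insert, Finset.sum_insert, Finset.sum_insert,
    Finset.sum_singleton, hS1, ← hNsum] at hsc
  · have hN : 0 < N := by
      rw [hsc]
      simp only [smul_eq_mul]
      omega
    refine ⟨_, _, _, _, hpos (q * r) (by simp), hpos (16 * q) (by simp),
      hpos (4 * (q * r)) (by simp), hpos (16 * r) (by simp), ?_,
      cnt_le h hN _ (by omega) _ (fun n => mem_L1 hq hr),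
      cnt_le h hN _ (by omega) _ (fun n => mem_L16 hq),
      cnt_le h hN _ (by omega) _ (fun n => mem_L4 hq hr),
      cnt_le h hN _ (by omega) _ (fun n => mem_L16 hr)⟩
    conv_lhs => rw [hsc]
    simp only [smul_eq_mul]
    ring
  all_goals
    simp only [Finset.mem_insert, Finset.mem_singleton]
    omega

theorem cs_val (h : Dat q r N cs u) {n : ℕ} (hn : n ∈ cs) :
    n ∣ 4 * (q * r) ∨ n ∣ 16 * q ∨ n ∣ 16 * r := by
  have h1 := h.hdiv n hn
  have h2 : u n ∈ cs.image u := Finset.mem_image_of_mem _ hn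
  rw [h.himg] at h2
  simp only [Finset.mem_insert, Finset.mem_singleton] at h2
  rcases h2 with h2 | h2 | h2 | h2 | h2 <;> rw [h2] at h1
  · left; exact h1.trans (one_dvd _)
  · left; exact h1.trans (Dvd.intro_left _ rfl)
  · right; left; exact h1
  · left; exact h1
  · right; right; exact h1

theorem dvd16_of (h : Dat q r N cs u) (hq : q.Prime) {n : ℕ} (hn : n ∈ cs)
    (hqn : ¬ q ∣ n) : n ∣ 16 * r := by
  have hco : Nat.Coprime n q := ((Nat.Prime.coprime_iff_not_dvd hq).2 hqn).symm
  rcases cs_val h hn with h1 | h1 | h1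
  · have : n ∣ (4 * r) * q := by convert h1 using 1; ring
    have := hco.dvd_of_dvd_mul_right this
    exact this.trans (Nat.mul_dvd_mul_right (by norm_num) _)
  · exact (hco.dvd_of_dvd_mul_right h1).trans (Dvd.intro _ rfl)
  · exact h1

theorem syl_of (h : Dat q r N cs u) (hq : q.Prime) (hr : r.Prime) (hqN : q ∣ N) (hN : 0 < N) :
    syl N q r = true := by
  rw [syl, Bool.or_eq_true]
  by_cases hqq : q * q ∣ N
  · left
    rw [beq_iff]
    exact Nat.mod_eq_zero_of_dvd hqq
  right
  obtain ⟨k, e, hk, hk1, he1, hep, hke, hdN, hf, hp1⟩ := h.hsyl q hq hqN hqq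
  have hqke : ¬ q ∣ k * e := by
    intro hd
    exact hqq ((Nat.mul_dvd_mul_right hd q).trans hdN)
  have h16 := dvd16_of h hq hke hqke
  have hke1 : k * e ≠ 1 := by
    intro h
    have := Nat.eq_one_of_mul_eq_one_right h
    omega
  rw [List.any_eq_true]
  refine ⟨k, mem_L16 hr ((Dvd.intro _ rfl).trans h16), ?_⟩
  simp only [Bool.and_eq_true, Nat.ble_eq, beq_iff, List.any_eq_true]
  refine ⟨⟨⟨hk1, hk⟩, fd_of hf⟩, e, mem_L16 hr ((Dvd.intro_left _ rfl).trans h16), ?_⟩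
  refine ⟨⟨⟨⟨⟨he1, Nat.mod_eq_zero_of_dvd hep⟩, Nat.mod_eq_zero_of_dvd hdN⟩,
    okk_of h hke hke1 hN⟩, ?_⟩, ?_⟩
  · rw [List.contains_iff_mem]
    exact mem_L16 hr h16
  · rw [Bool.or_eq_true, beq_iff]
    by_cases hkp : k = q + 1
    · right; exact hp1 hkp
    · left
      rw [Bool.not_eq_true', Bool.eq_false_iff]
      intro hh
      exact hkp (beq_iff.mp hh)

theorem dvd_of_dat (h : Dat q r N cs u) (hq : q.Prime) (hr : r.Prime) (hq3 : 3 ≤ q) (hr3 : 3 ≤ r)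
    (hqr : q ≠ r) : r ∣ N := by
  by_contra hrN
  obtain ⟨a1, a2, a3, a4, h1, h2, h3, h4, hN, -⟩ := card_eq h hq hr hq3 hr3 hqr
  have hge : 9 ≤ q * r := Nat.mul_le_mul hq3 hr3
  have b1 : q * r ≤ a1 * (q * r) := Nat.le_mul_of_pos_left _ h1
  have b2 : 16 * q ≤ a2 * (16 * q) := Nat.le_mul_of_pos_left _ h2
  have b3 : 4 * (q * r) ≤ a3 * (4 * (q * r)) := Nat.le_mul_of_pos_left _ h3
  have b4 : 16 * r ≤ a4 * (16 * r) := Nat.le_mul_of_pos_left _ h4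
  obtain ⟨n, hn, hun⟩ : ∃ n ∈ cs, u n = q * r := by
    rw [← Finset.mem_image, h.himg]; simp
  have hnd : n ∣ q * r := hun ▸ h.hdiv n hn
  have hn1 : n ≠ 1 := by
    rintro rfl
    have := h.hu1
    omega
  have hnr : ¬ r ∣ n := fun hh => hrN (hh.trans (h.hdN n hn))
  have hco : Nat.Coprime n r := ((Nat.Prime.coprime_iff_not_dvd hr).2 hnr).symm
  have hnq : n = q := ((Nat.dvd_prime hq).1 (hco.dvd_of_dvd_mul_right hnd)).resolve_left hn1
  subst hnq
  have hqN := h.hdN n hn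
  have hNf := h.hfac n hn hn1
  have hqq : ¬ n * n ∣ N := by
    intro hh
    have h5 := hh.trans hNf
    have h6 : n.factorial = n * (n - 1).factorial := (Nat.mul_factorial_pred (by omega)).symm
    rw [h6] at h5
    have h7 := Nat.dvd_of_mul_dvd_mul_left (by omega) h5
    have := (hq.dvd_factorial).1 h7
    omega
  obtain ⟨k, e, hk, hk1, he1, hep, hke, hdN, hf, hp1⟩ := h.hsyl n hq hqN hqq
  have hqke : ¬ n ∣ k * e := fun hd => hqq ((Nat.mul_dvd_mul_right hd n).trans hdN)
  have h16 := dvd16_of h hq hke hqke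
  have hrke : ¬ r ∣ k * e := fun hd => hrN (hd.trans (h.hdN _ hke))
  have hco2 : Nat.Coprime (k * e) r := ((Nat.Prime.coprime_iff_not_dvd hr).2 hrke).symm
  have h16 := hco2.dvd_of_dvd_mul_right h16
  have hle := Nat.le_of_dvd (by norm_num) h16
  have hk16 : k ∣ 16 := (Dvd.intro _ rfl).trans h16
  have hkn : n ∣ k - 1 := (Nat.modEq_iff_dvd' hk1.le).1 (by
    rw [Nat.ModEq, hk, Nat.mod_eq_of_lt hq.one_lt])
  rcases dvd16 hk16 with rfl | rfl | rfl | rfl | rfl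
  · omega
  · have := Nat.le_of_dvd (by norm_num) hkn
    omega
  · have := Nat.le_of_dvd (by norm_num) hkn
    have : n = 3 := by omega
    subst this
    have := Nat.le_of_dvd (by norm_num [Nat.factorial]) hNf
    norm_num [Nat.factorial] at this
    omega
  · have : n = 7 := ((Nat.dvd_prime (by norm_num)).1 hkn).resolve_left (by omega)
    subst this
    have := hp1 rfl
    omega
  · omega

theorem sp_of {n : ℕ} (hn : n.Prime) : sp n = true := by
  have : ∀ d, d.Prime → (!(Nat.beq (n % d) 0) || Nat.beq n d) = true := by
    intro d hd
    by_cases h : n % d = 0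
    · rw [Bool.or_eq_true]
      right
      rw [beq_iff]
      exact ((Nat.prime_dvd_prime_iff_eq hd hn).1 (Nat.dvd_of_mod_eq_zero h)).symm
    · rw [Bool.or_eq_true]
      left
      rw [Bool.not_eq_true', Bool.eq_false_iff]
      intro hh
      exact h (beq_iff.mp hh)
  rw [sp, List.all_eq_true]
  intro d hd
  apply this
  simp only [List.mem_cons, List.not_mem_nil, or_false] at hd
  rcases hd with rfl | rfl | rfl | rfl <;> norm_num

theorem mem_rng {a n : ℕ} (h0 : 0 < a) (h : a ≤ n) : a ∈ rng n := by
  rw [rng, List.mem_map]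
  exact ⟨a - 1, List.mem_range.2 (by omega), by omega⟩

theorem cnt_lt (N : ℕ) (l : List ℕ) : cnt N (1 :: l) ≤ l.length := by
  have : okk N 1 = false := rfl
  rw [cnt, List.filter_cons_of_neg (by simp [this])]
  exact List.length_filter_le _ _

theorem arith (h : Dat q r N cs u) (hq : q.Prime) (hr : r.Prime) (hq3 : 3 ≤ q) (hr3 : 3 ≤ r)
    (hqr : q < r) : False := by
  have hrN := dvd_of_dat h hq hr hq3 hr3 hqr.ne
  have hqN := dvd_of_dat h.symm hr hq hr3 hq3 hqr.ne'
  obtain ⟨a1, a2, a3, a4, h1, h2, h3, h4, hN, c1, c2, c3, c4⟩ := card_eq h hq hr hq3 hr3 hqr.ne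
  have hN0 : 0 < N := by omega
  have s1 := syl_of h hq hr hqN hN0
  have s2 := syl_of h.symm hr hq hrN hN0
  have d1 : a1 ≤ 3 := c1.trans (cnt_lt N _)
  have d2 : a2 ≤ 9 := c2.trans (cnt_lt N _)
  have d3 : a3 ≤ 11 := c3.trans (cnt_lt N _)
  have d4 : a4 ≤ 9 := c4.trans (cnt_lt N _)
  have hdvd : q * r ∣ N :=
    Nat.Coprime.mul_dvd_of_dvd_of_dvd ((Nat.coprime_primes hq hr).2 hqr.ne) hqN hrN
  have hdvd2 : q * r ∣ 1 + 16 * a2 * q + 16 * a4 * r := by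
    have e : N = (1 + 16 * a2 * q + 16 * a4 * r) + (q * r) * (a1 + 4 * a3) := by rw [hN]; ring
    rw [e] at hdvd
    exact (Nat.dvd_add_left (Dvd.intro _ rfl)).1 hdvd
  obtain ⟨t, ht⟩ := hdvd2
  have hNt : N = q * r * (t + a1 + 4 * a3) := by
    calc N = (1 + 16 * a2 * q + 16 * a4 * r) + (q * r) * (a1 + 4 * a3) := by rw [hN]; ring
      _ = _ := by rw [ht]; ring
  have ht0 : 0 < t := by
    rcases Nat.eq_zero_or_pos t with h | h
    · subst h; omega
    · exact h
  have e1 : (t * q) * r = 1 + 16 * a2 * q + 16 * a4 * r := by rw [ht]; ring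
  have hlt : t * q < 289 := by
    have f1 : 16 * a2 * q ≤ 144 * q := Nat.mul_le_mul_right _ (by omega)
    have f2 : 16 * a4 * r ≤ 144 * r := Nat.mul_le_mul_right _ (by omega)
    have : (t * q) * r < 289 * r := by omega
    exact Nat.lt_of_mul_lt_mul_right this
  have hq290 : q < 290 := by
    have : q ≤ t * q := Nat.le_mul_of_pos_left _ ht0
    omega
  have hgt : 16 * a4 < t * q := by
    have : 16 * a4 * r < (t * q) * r := by omega
    exact Nat.lt_of_mul_lt_mul_right this
  have e2 : (t * q - 16 * a4) * r = 1 + 16 * a2 * q := by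
    rw [Nat.sub_mul, e1]; omega
  have e3 : (1 + 16 * a2 * q) / (t * q - 16 * a4) = r := by
    rw [← e2]; exact Nat.mul_div_cancel_left _ (by omega)
  have e4 : (1 + 16 * a2 * q) % (t * q - 16 * a4) = 0 := by
    rw [← e2]; exact Nat.mul_mod_right _ _
  have hc := chk_all q (List.mem_range.2 hq290)
  simp only [chk, Bool.or_eq_true, Nat.ble_eq, sp_of hq, Bool.not_true, Bool.false_eq_true, or_false,
    List.all_eq_true] at hc
  have hc := hc.resolve_left (by omega) t (mem_rng ht0 ((Nat.le_div_iff_mul_le (by omega)).2 hlt.le))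
    a2 (mem_rng h2 d2) a4 (mem_rng h4 d4)
  simp only [chk2, e3, e4, Bool.or_eq_true, Nat.ble_eq, sp_of hr, Bool.not_true, Bool.false_eq_true,
    or_false, List.all_eq_true, beq_iff, Bool.not_eq_true'] at hc
  have hb : Nat.beq 0 0 = true := rfl
  have hgood : good q r t a1 a2 a3 a4 = true := by
    simp only [good, ← hNt, Bool.and_eq_true, Nat.ble_eq]
    exact ⟨⟨⟨⟨⟨c1, c2⟩, c3⟩, c4⟩, s1⟩, s2⟩
  rcases hc with ((hc | hc) | hc) | hc
  · omega
  · rw [hb] at hc; cases hc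
  · omega
  · have := hc a1 (mem_rng h1 d1) a3 (mem_rng h3 d3)
    rw [hgood] at this
    cases this
end
end Aux17

theorem stmt_17 (r q : ℕ) (hr : r.Prime) (hq : q.Prime) (hor : Odd r)
    (hoq : Odd q) (hrq : r ≠ q) (G : Type*) [Group G] [Finite G]
    [IsSimpleGroup G] (hna : ¬ ∀ a b : G, a * b = b * a)
    (hU : sameSizeSet G = {1, r * q, 16 * q, 4 * q * r, 16 * r}) :
    (Set.range fun x : G => classSize x).ncard = 5 := by
  exfalso
  obtain ⟨cs, hcs, hsum⟩ := Aux17.sum_count (G := G)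
  have h1 : classSize (1 : G) = 1 := (Aux17.classSize_one_iff hna 1).2 rfl
  have hD : Aux17.Dat q r (Nat.card G) cs (sameSizeCount G) := by
    refine ⟨hsum, fun n _ => Aux17.classSize_dvd_count n, ?_, (hcs 1).2 ⟨1, h1⟩, ?_, ?_, ?_, ?_⟩
    · intro n hn
      obtain ⟨x, rfl⟩ := (hcs n).1 hn
      rw [Aux17.classSize_eq_index]
      exact Subgroup.index_dvd_card _
    · rw [sameSizeCount, Nat.card_eq_one_iff_unique]
      refine ⟨⟨fun a b => Subtype.ext ?_⟩, ⟨⟨1, h1⟩⟩⟩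
      rw [(Aux17.classSize_one_iff hna _).1 a.2, (Aux17.classSize_one_iff hna _).1 b.2]
    · intro n hn hn1
      obtain ⟨x, rfl⟩ := (hcs n).1 hn
      rw [Aux17.classSize_eq_index] at hn1 ⊢
      exact Aux17.dvd_factorial _ hn1
    · ext m
      have hm : m ∈ sameSizeSet G ↔ m ∈ ({1, r * q, 16 * q, 4 * q * r, 16 * r} : Set ℕ) := by
        rw [hU]
      have hm2 : m ∈ cs.image (sameSizeCount G) ↔ m ∈ sameSizeSet G := by
        rw [Finset.mem_image]
        constructor
        · rintro ⟨n, hn, rfl⟩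
          obtain ⟨x, rfl⟩ := (hcs n).1 hn
          exact ⟨x, rfl⟩
        · rintro ⟨x, rfl⟩
          exact ⟨_, (hcs _).2 ⟨x, rfl⟩, rfl⟩
      rw [hm2, hm, mul_comm r q, mul_assoc 4 q r]
      simp
    · intro p hp hpN hpp
      obtain ⟨k, e, a1, a2, a3, a4, a5, a6⟩ := Aux17.sylow_data hna hp hpN hpp
      exact ⟨k, e, a1, a2, a3, a4, (hcs _).2 a5, a6⟩
  have hr3 : 3 ≤ r := by
    have := hr.two_le
    obtain ⟨k, hk⟩ := hor
    omega
  have hq3 : 3 ≤ q := by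
    have := hq.two_le
    obtain ⟨k, hk⟩ := hoq
    omega
  rcases lt_or_gt_of_ne hrq with h | h
  · exact Aux17.arith hD.symm hr hq hr3 hq3 h
  · exact Aux17.arith hD hq hr hq3 hr3 h
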